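/- arXiv:1309.7746 — 3 statements merged into one kernel-verified Lean document; each statement's English description precedes it below -/
import Mathlib

section
/- Let n ≥ 1 and let H ∈ M_{2n,2n}(ℂ) be symplectic (Hᵗ J_{2n} H = J_{2n}) and Hermitian (H = H̄ᵗ). Then there exist an integer p with 0 ≤ p ≤ n and a symplectic matrix V ∈ M_{2n,2n}(ℂ) such that H = V H^{2n}_p V̄ᵗ, where 2p equals the number of positive eigenvalues of H counted with multiplicity (in particular the number of positive eigenvalues of H is even). -/
open Matrix

/-- `J_{2n} = [[0, I_n], [−I_n, 0]]`. -/
noncomputable def Jmat (n : ℕ) : Matrix (Fin (2 * n)) (Fin (2 * n)) ℂ :=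
  Matrix.of fun i j =>
    if (i : ℕ) + n = (j : ℕ) then 1 else if (j : ℕ) + n = (i : ℕ) then -1 else 0

/-- `H^{2n}_p = diag(S^n_p, S^n_p)` where `S^n_p = diag(I_p, −I_{n−p})`. -/
noncomputable def Hmat (n p : ℕ) : Matrix (Fin (2 * n)) (Fin (2 * n)) ℂ :=
  Matrix.diagonal fun i => if (i : ℕ) % n < p then 1 else -1

/-- Sylvester's law of inertia, as an inequality between the numbers of positive diagonal entries
of two Hermitian-congruent real diagonal matrices. -/
theorem card_pos_le_of_diagonal_congr {ι κ : Type*} [Fintype ι] [Fintype κ] [DecidableEq ι]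
    [DecidableEq κ] (d : ι → ℝ) (e : κ → ℝ) (M : Matrix ι κ ℂ)
    (hM : diagonal (fun i => (d i : ℂ)) = M * diagonal (fun i => (e i : ℂ)) * Mᴴ) :
    Fintype.card {i // 0 < d i} ≤ Fintype.card {i // 0 < e i} := by
  classical
  let A : Matrix {i // 0 < e i} {i // 0 < d i} ℂ := Mᴴ.submatrix Subtype.val Subtype.val
  have hA : Function.Injective A.mulVecLin := by
    rw [← LinearMap.ker_eq_bot, LinearMap.ker_eq_bot']
    intro x hx
    let z : ι → ℂ := fun i => if h : 0 < d i then x ⟨i, h⟩ else 0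
    let y : κ → ℂ := Mᴴ *ᵥ z
    have hy : ∀ j, 0 < e j → y j = 0 := by
      intro j hj
      have h := congrFun hx ⟨j, hj⟩
      rw [← show A.mulVecLin x ⟨j, hj⟩ = y j from ?_]
      · exact h
      · simp only [mulVecLin_apply, mulVec, dotProduct, A, submatrix_apply, y, z]
        rw [← Fintype.sum_subtype_add_sum_subtype (fun i => 0 < d i),
          Fintype.sum_eq_zero (fun i : {i // ¬ 0 < d i} => _) fun i => by simp [i.2], add_zero]
        exact Finset.sum_congr rfl fun i _ => by simp [i.2]
    have key : star z ⬝ᵥ (diagonal (fun i => (d i : ℂ)) *ᵥ z)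
        = star y ⬝ᵥ (diagonal (fun i => (e i : ℂ)) *ᵥ y) := by
      rw [hM, ← mulVec_mulVec, ← mulVec_mulVec, dotProduct_mulVec]
      congr 1
      simp [y, star_mulVec]
    have hsum : ∑ i, d i * Complex.normSq (z i) = ∑ j, e j * Complex.normSq (y j) := by
      have key' := key
      simp only [dotProduct, mulVec_diagonal, Pi.star_apply] at key'
      apply Complex.ofReal_injective
      push_cast
      simp only [Complex.normSq_eq_conj_mul_self]
      convert key' using 2 with i _ i _
      · simp; ring
      · simp; ring
    have hz : ∀ i, 0 ≤ d i * Complex.normSq (z i) := by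
      intro i
      by_cases h : 0 < d i
      · exact mul_nonneg h.le (Complex.normSq_nonneg _)
      · simp [z, h]
    have hr : ∑ j, e j * Complex.normSq (y j) ≤ 0 := by
      refine Finset.sum_nonpos fun j _ => ?_
      by_cases h : 0 < e j
      · simp [hy j h]
      · exact mul_nonpos_of_nonpos_of_nonneg (not_lt.1 h) (Complex.normSq_nonneg _)
    have h0 := (Finset.sum_eq_zero_iff_of_nonneg fun i _ => hz i).1
      (le_antisymm (hsum.trans_le hr) (Finset.sum_nonneg fun i _ => hz i))
    ext ⟨i, hi⟩
    have := h0 i (Finset.mem_univ i)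
    simpa [z, hi, hi.ne'] using this
  simpa using LinearMap.finrank_le_finrank_of_injective hA

/-- A nondegenerate Hermitian form compatible with a quaternionic structure `τ` admits families
of orthonormal vectors spanning `τ`-stable subspaces, up to half the dimension of the space. -/
theorem exists_quaternionic_orthonormal {E : Type*} [AddCommGroup E] [Module ℂ E]
    [FiniteDimensional ℂ E] (h : E →ₗ⋆[ℂ] E →ₗ[ℂ] ℂ) (τ : E → E)
    (herm : ∀ x y, star (h x y) = h y x) (nondeg : ∀ x, (∀ y, h x y = 0) → x = 0)
    (hττ : ∀ x, τ (τ x) = -x) (hτ : ∀ x y, h (τ x) (τ y) = h y x) (k : ℕ)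
    (hk : 2 * k ≤ Module.finrank ℂ E) :
    ∃ (v : Fin k → E) (ε : Fin k → ℝ), (∀ i, ε i = 1 ∨ ε i = -1) ∧
      (∀ i j, h (v i) (v j) = if i = j then (ε i : ℂ) else 0) ∧
      ∀ i j, h (τ (v i)) (v j) = 0 := by
  have hanti : ∀ x y, h (τ x) y = -h (τ y) x := by
    intro x y
    have := hτ x (τ y)
    rw [hττ, map_neg] at this
    rw [← this, neg_neg]
  induction k with
  | zero => exact ⟨Fin.elim0, Fin.elim0, fun i => i.elim0, fun i => i.elim0, fun i => i.elim0⟩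
  | succ k ih =>
    obtain ⟨v, ε, hε, hv, hτv⟩ := ih (by omega)
    have hεε : ∀ i, (ε i : ℂ) * ε i = 1 := fun i => by
      rcases hε i with h | h <;> simp [h]
    have hvτ : ∀ i j, h (v i) (τ (v j)) = 0 := fun i j => by
      rw [← herm, hτv, star_zero]
    let P : E → E := fun y => y - ∑ i, (ε i * h (v i) y) • v i
      - ∑ i, (ε i * h (τ (v i)) y) • τ (v i)
    have hP : ∀ j y, h (v j) (P y) = 0 ∧ h (τ (v j)) (P y) = 0 := by
      intro j y
      constructor
      · simp [P, hv, hvτ, mul_right_comm, hεε]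
      · simp [P, hτ, hv, hτv, mul_right_comm, hεε]
    have hP' : ∀ y j, h (P y) (v j) = 0 ∧ h (P y) (τ (v j)) = 0 := fun y j => by
      rw [← herm, ← herm _ (P y), (hP j y).1, (hP j y).2, star_zero]
      simp
    obtain ⟨x, hx, hx1, hx2⟩ : ∃ x, h x x ≠ 0 ∧ (∀ j, h (v j) x = 0) ∧
        ∀ j, h (τ (v j)) x = 0 := by
      by_contra! hcon
      have hW : ∀ x, (∀ j, h (v j) x = 0 ∧ h (τ (v j)) x = 0) → h x x = 0 := by
        intro x hx
        by_contra hne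
        obtain ⟨j, hj⟩ := hcon x hne fun j => (hx j).1
        exact hj (hx j).2
      have hPP : ∀ y z, h (P y) (P z) = 0 := by
        intro y z
        have hy := hW (P y) fun j => hP j y
        have hz := hW (P z) fun j => hP j z
        have h1 := hW (P y + P z) fun j => by simp [hP]
        have h2 := hW (P y + Complex.I • P z) fun j => by simp [hP]
        simp only [map_add, LinearMap.add_apply, hy, hz, map_smul, map_smulₛₗ,
          LinearMap.smul_apply, smul_eq_mul, Complex.conj_I] at h1 h2
        linear_combination (1 / 2 : ℂ) * h1 - (Complex.I / 2) * h2 +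
          (h (P y) (P z) - h (P z) (P y)) / 2 * Complex.I_sq
      have hP0 : ∀ y, P y = 0 := by
        intro y
        apply nondeg
        intro z
        rw [← hPP y z]
        change _ = h (P y) (z - _ - _)
        simp only [map_sub, map_sum, map_smul, hP', smul_zero, Finset.sum_const_zero, sub_zero]
      have hspan : Submodule.span ℂ (Set.range (Sum.elim v fun i => τ (v i))) = ⊤ := by
        rw [eq_top_iff]
        intro y _
        have : y = ∑ i, (ε i * h (v i) y) • v i + ∑ i, (ε i * h (τ (v i)) y) • τ (v i) := by
          rw [← sub_eq_zero, ← sub_sub]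
          exact hP0 y
        rw [this]
        refine add_mem (sum_mem fun i _ => ?_) (sum_mem fun i _ => ?_)
        · exact Submodule.smul_mem _ _ (Submodule.subset_span ⟨Sum.inl i, rfl⟩)
        · exact Submodule.smul_mem _ _ (Submodule.subset_span ⟨Sum.inr i, rfl⟩)
      have := finrank_range_le_card (R := ℂ) (Sum.elim v fun i => τ (v i))
      rw [Set.finrank, hspan, finrank_top] at this
      simp at this
      omega
    obtain ⟨r, hr⟩ : ∃ r : ℝ, h x x = r := by
      obtain ⟨r, hr⟩ := Complex.conj_eq_iff_real.1 (herm x x)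
      exact ⟨r, hr⟩
    have hr0 : r ≠ 0 := by
      rintro rfl
      exact hx (by simpa using hr)
    let c : ℂ := ((√|r|)⁻¹ : ℝ)
    let x' := c • x
    have hx' : h x' x' = ((r / |r| : ℝ) : ℂ) := by
      simp only [x', c, map_smul, map_smulₛₗ, LinearMap.smul_apply, smul_eq_mul, hr,
        Complex.conj_ofReal]
      norm_cast
      rw [← mul_assoc, ← mul_inv, Real.mul_self_sqrt (abs_nonneg r), div_eq_inv_mul]
    have hvx : ∀ j, h (v j) x' = 0 := fun j => by simp [x', hx1]
    have hτx : ∀ j, h (τ (v j)) x' = 0 := fun j => by simp [x', hx2]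
    refine ⟨Fin.cons x' v, Fin.cons (r / |r|) ε, ?_, ?_, ?_⟩
    · refine Fin.cases ?_ hε
      rcases lt_or_gt_of_ne hr0 with hlt | hgt
      · right; simp [abs_of_neg hlt, hr0]
      · left; simp [abs_of_pos hgt, hr0]
    · intro i j
      refine Fin.cases ?_ (fun i => ?_) i <;> refine Fin.cases ?_ (fun j => ?_) j
      · simpa using hx'
      · rw [← herm]
        simp [hvx, (Fin.succ_ne_zero j).symm]
      · simp [hvx]
      · simp [hv]
    · intro i j
      refine Fin.cases ?_ (fun i => ?_) i <;> refine Fin.cases ?_ (fun j => ?_) j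
      · exact self_eq_neg.1 (hanti x' x')
      · simp only [Fin.cons_zero, Fin.cons_succ]
        rw [hanti, hτx, neg_zero]
      · simp [hτx]
      · simp [hτv]

/-- The number of positive eigenvalues of a Hermitian matrix can be read off any diagonal matrix
congruent to it. -/
theorem Matrix.IsHermitian.card_pos_eigenvalues_of_congr {ι : Type*} [Fintype ι] [DecidableEq ι]
    {A : Matrix ι ι ℂ} (hA : A.IsHermitian) (d : ι → ℝ) (V : Matrix ι ι ℂ) (hV : IsUnit V.det)
    (h : A = V * diagonal (fun i => (d i : ℂ)) * Vᴴ) :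
    Fintype.card {i // 0 < hA.eigenvalues i} = Fintype.card {i // 0 < d i} := by
  let U : Matrix ι ι ℂ := hA.eigenvectorUnitary
  have hU : Uᴴ * U = 1 := Unitary.coe_star_mul_self hA.eigenvectorUnitary
  have hA' : A = U * diagonal (fun i => (hA.eigenvalues i : ℂ)) * Uᴴ := hA.spectral_theorem
  have hV' : V⁻¹ * V = 1 := nonsing_inv_mul _ hV
  have congr_of_eq : ∀ {X Y D E : Matrix ι ι ℂ} (Z : Matrix ι ι ℂ), Z * X = 1 →
      X * D * Xᴴ = Y * E * Yᴴ → D = Z * Y * E * (Z * Y)ᴴ := by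
    intro X Y D E Z hZ hXY
    calc D = (Z * X) * D * (Z * X)ᴴ := by simp [hZ]
      _ = Z * (X * D * Xᴴ) * Zᴴ := by simp only [conjTranspose_mul, Matrix.mul_assoc]
      _ = Z * Y * E * (Z * Y)ᴴ := by rw [hXY]; simp only [conjTranspose_mul, Matrix.mul_assoc]
  exact le_antisymm
    (card_pos_le_of_diagonal_congr _ _ _ (congr_of_eq Uᴴ hU (hA'.symm.trans h)))
    (card_pos_le_of_diagonal_congr _ _ _ (congr_of_eq V⁻¹ hV' (h.symm.trans hA')))

/-- A sign vector can be permuted so that its positive entries come first. -/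
theorem exists_perm_comp_eq_ite {n : ℕ} (ε : Fin n → ℝ) (hε : ∀ i, ε i = 1 ∨ ε i = -1) :
    ∃ p ≤ n, ∃ σ : Equiv.Perm (Fin n), ∀ i, ε (σ i) = if (i : ℕ) < p then 1 else -1 := by
  classical
  have hle : Fintype.card {i // ε i = 1} ≤ n := by
    simpa using Fintype.card_subtype_le fun i => ε i = 1
  refine ⟨Fintype.card {i // ε i = 1}, hle, ?_⟩
  have hcard : Fintype.card {i : Fin n // (i : ℕ) < Fintype.card {i // ε i = 1}} =
      Fintype.card {i // ε i = 1} := by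
    conv_rhs => rw [← Fintype.card_fin (Fintype.card {i // ε i = 1})]
    exact Fintype.card_congr (Fin.castLEquiv hle).symm
  let f := Fintype.equivOfCardEq hcard
  refine ⟨f.extendSubtype, fun i => ?_⟩
  split_ifs with hi
  · exact f.extendSubtype_mem i hi
  · exact (hε _).resolve_left (f.extendSubtype_not_mem i hi)

theorem conjTranspose_mem_symplecticGroup {l : Type*} [Fintype l] [DecidableEq l]
    {A : Matrix (l ⊕ l) (l ⊕ l) ℂ} (hA : A ∈ symplecticGroup l ℂ) :
    Aᴴ ∈ symplecticGroup l ℂ := by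
  have hJ : (J l ℂ)ᴴ = -J l ℂ := by
    simp [J, fromBlocks_conjTranspose, fromBlocks_neg]
  have h := congrArg conjTranspose (SymplecticGroup.mem_iff.1 hA)
  rw [conjTranspose_mul, conjTranspose_mul, hJ, Matrix.neg_mul, Matrix.mul_neg, neg_inj,
    ← Matrix.mul_assoc] at h
  exact SymplecticGroup.mem_iff'.2 h

/-- Hermitian symplectic matrices are diagonalised by symplectic congruences. -/
theorem exists_symplectic_congr_diagonal {n : ℕ} {H : Matrix (Fin n ⊕ Fin n) (Fin n ⊕ Fin n) ℂ}
    (hs : H ∈ symplecticGroup (Fin n) ℂ) (hH : H.IsHermitian) :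
    ∃ p ≤ n, ∃ V ∈ symplecticGroup (Fin n) ℂ, H = V * diagonal (fun i =>
      ((Sum.elim (fun i : Fin n => if (i : ℕ) < p then 1 else -1)
        (fun i : Fin n => if (i : ℕ) < p then 1 else -1) i : ℝ) : ℂ)) * Vᴴ := by
  have hs' := SymplecticGroup.mem_iff'.1 hs
  have hsm : ∀ x, Hᵀ *ᵥ J (Fin n) ℂ *ᵥ H *ᵥ x = J (Fin n) ℂ *ᵥ x := fun x => by
    simp only [mulVec_mulVec, ← Matrix.mul_assoc, hs']
  have hJJ : ∀ x, J (Fin n) ℂ *ᵥ J (Fin n) ℂ *ᵥ x = -x := fun x => by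
    rw [mulVec_mulVec, J_squared, neg_mulVec, one_mulVec]
  have hJstar : ∀ x, star (J (Fin n) ℂ *ᵥ x) = J (Fin n) ℂ *ᵥ star x := fun x => by
    rw [star_mulVec, ← mulVec_transpose]
    congr 1
    simp [J, fromBlocks_conjTranspose, fromBlocks_transpose]
  have hHstar : ∀ x, star (H *ᵥ x) = Hᵀ *ᵥ star x := fun x => by
    rw [star_mulVec, hH.eq, mulVec_transpose]
  let h : (Fin n ⊕ Fin n → ℂ) →ₗ⋆[ℂ] (Fin n ⊕ Fin n → ℂ) →ₗ[ℂ] ℂ :=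
    LinearMap.mk₂'ₛₗ (starRingEnd ℂ) (RingHom.id ℂ) (fun x y => star x ⬝ᵥ H *ᵥ y)
      (by simp) (by simp) (by simp [mulVec_add]) (by simp [mulVec_smul])
  have h_apply : ∀ x y, h x y = star x ⬝ᵥ H *ᵥ y := fun _ _ => rfl
  have h_apply' : ∀ x y, h x y = star (H *ᵥ x) ⬝ᵥ y := fun x y => by
    rw [h_apply, dotProduct_mulVec, star_mulVec, hH.eq]
  let τ : (Fin n ⊕ Fin n → ℂ) → (Fin n ⊕ Fin n → ℂ) := fun x => J (Fin n) ℂ *ᵥ star (H *ᵥ x)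
  have hω : ∀ x y, h (τ x) y = -(x ⬝ᵥ J (Fin n) ℂ *ᵥ y) := fun x y => by
    rw [h_apply, hJstar, star_star, ← hsm y, ← vecMul_transpose, ← dotProduct_mulVec, J_transpose,
      neg_mulVec, dotProduct_neg, dotProduct_mulVec x, vecMul_transpose]
  have hττ : ∀ x, τ (τ x) = -x := fun x => by
    simp only [τ]
    rw [hHstar, hJstar, star_star, hsm, hJJ]
  have herm : ∀ x y, star (h x y) = h y x := fun x y => by
    rw [h_apply', h_apply, star_dotProduct, star_star]
  have hτ : ∀ x y, h (τ x) (τ y) = h y x := fun x y => by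
    rw [hω, hJJ, dotProduct_neg, neg_neg, h_apply', dotProduct_comm]
  have nondeg : ∀ x, (∀ y, h x y = 0) → x = 0 := fun x hx => by
    have h0 : star (H *ᵥ x) = 0 := dotProduct_eq_zero _ fun y => by rw [← h_apply', hx]
    have hx0 : τ x = 0 := by simp only [τ, h0, mulVec_zero]
    rw [← neg_eq_zero, ← hττ, hx0]
    simp [τ]
  obtain ⟨v, ε, hε, hv, hτv⟩ := exists_quaternionic_orthonormal h τ herm nondeg hττ hτ n
    (by simp [two_mul])
  obtain ⟨p, hp, σ, hσ⟩ := exists_perm_comp_eq_ite ε hε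
  let w : Fin n ⊕ Fin n → (Fin n ⊕ Fin n → ℂ) :=
    Sum.elim (fun i => v (σ i)) fun i => (ε (σ i) : ℂ) • τ (v (σ i))
  let W : Matrix (Fin n ⊕ Fin n) (Fin n ⊕ Fin n) ℂ := (of w)ᵀ
  have hεε : ∀ i, (ε i : ℂ) * ε i = 1 := fun i => by
    rcases hε i with h | h <;> simp [h]
  have hvτ : ∀ i j, h (v i) (τ (v j)) = 0 := fun i j => by
    rw [← herm, hτv, star_zero]
  have hτ_smul : ∀ i x, τ ((ε i : ℂ) • x) = (ε i : ℂ) • τ x := fun i x => by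
    simp [τ, mulVec_smul]
  have hW : W ∈ symplecticGroup (Fin n) ℂ := by
    rw [SymplecticGroup.mem_iff']
    ext i j
    have : (Wᵀ * J (Fin n) ℂ * W) i j = w i ⬝ᵥ J (Fin n) ℂ *ᵥ w j := by
      rw [Matrix.mul_assoc]
      rfl
    rw [this, ← neg_neg (w i ⬝ᵥ _), ← hω]
    rcases i with i | i <;> rcases j with j | j
    · simp [w, hτv, J]
    · rcases eq_or_ne i j with rfl | hij
      · simp [w, hτ, hv, J, hεε]
      · simp [w, hτ, hv, J, hij, hij.symm]
    · simp only [w, Sum.elim_inl, Sum.elim_inr, hτ_smul, hττ, map_smulₛₗ, LinearMap.smul_apply,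
        map_neg, LinearMap.neg_apply, hv]
      rcases eq_or_ne i j with rfl | hij
      · simp [J, hεε]
      · simp [J, hij]
    · simp only [w, Sum.elim_inr, hτ_smul, hττ, map_smulₛₗ, LinearMap.smul_apply, map_neg,
        LinearMap.neg_apply, hvτ]
      simp [J]
  have hWH : Wᴴ * H * W = diagonal (fun i =>
      ((Sum.elim (fun i : Fin n => if (i : ℕ) < p then 1 else -1)
        (fun i : Fin n => if (i : ℕ) < p then 1 else -1) i : ℝ) : ℂ)) := by
    ext i j
    have : (Wᴴ * H * W) i j = h (w i) (w j) := by
      rw [Matrix.mul_assoc]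
      rfl
    rw [this]
    rcases i with i | i <;> rcases j with j | j
    · simp [w, hv, diagonal_apply, ← hσ]
    · simp [w, hvτ]
    · simp only [w, Sum.elim_inl, Sum.elim_inr, map_smulₛₗ, LinearMap.smul_apply, hτv]
      simp
    · simp only [w, Sum.elim_inr, map_smulₛₗ, LinearMap.smul_apply, hτ, hv, diagonal_apply, ← hσ]
      rcases eq_or_ne i j with rfl | hij
      · simp [hεε]
      · simp [hij, hij.symm]
  have hu := SymplecticGroup.symplectic_det hW
  refine ⟨p, hp, (W⁻¹)ᴴ, ?_, ?_⟩
  · apply conjTranspose_mem_symplecticGroup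
    have := (⟨W, hW⟩ : symplecticGroup (Fin n) ℂ)⁻¹.2
    rwa [SymplecticGroup.coe_inv'] at this
  · rw [← hWH, conjTranspose_conjTranspose, ← Matrix.mul_assoc, ← Matrix.mul_assoc,
      ← conjTranspose_mul, Matrix.mul_nonsing_inv _ hu, conjTranspose_one, Matrix.one_mul,
      Matrix.mul_assoc, Matrix.mul_nonsing_inv _ hu, Matrix.mul_one]

/-- The two halves of `Fin (2 * n)`. -/
def finSumFinEquivTwoMul (n : ℕ) : Fin n ⊕ Fin n ≃ Fin (2 * n) :=
  finSumFinEquiv.trans (finCongr (two_mul n).symm)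

theorem Jmat_submatrix (n : ℕ) :
    (Jmat n).submatrix (finSumFinEquivTwoMul n) (finSumFinEquivTwoMul n) = -J (Fin n) ℂ := by
  ext (i | i) (j | j)
  all_goals
    have := i.2
    have := j.2
    simp [Jmat, finSumFinEquivTwoMul, J, one_apply, Fin.ext_iff]
    try grind

/-- Every symplectic Hermitian matrix `H` equals `V H^{2n}_p V̄ᵗ` for some symplectic `V`,
where `2p` is the number of positive eigenvalues of `H`. -/
theorem stmt_9 (n : ℕ) (hn : 1 ≤ n) (H : Matrix (Fin (2 * n)) (Fin (2 * n)) ℂ)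
    (hs : Hᵀ * Jmat n * H = Jmat n) (hH : H.IsHermitian) :
    ∃ p : ℕ, p ≤ n ∧ 2 * p = Fintype.card {i // 0 < hH.eigenvalues i} ∧
      ∃ V : Matrix (Fin (2 * n)) (Fin (2 * n)) ℂ,
        Vᵀ * Jmat n * V = Jmat n ∧ H = V * Hmat n p * Vᴴ := by
  classical
  let e := finSumFinEquivTwoMul n
  have mem_iff : ∀ A : Matrix (Fin (2 * n)) (Fin (2 * n)) ℂ,
      A.submatrix e e ∈ symplecticGroup (Fin n) ℂ ↔ Aᵀ * Jmat n * A = Jmat n := by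
    intro A
    rw [SymplecticGroup.mem_iff', ← neg_inj, ← Matrix.neg_mul, ← Matrix.mul_neg,
      ← Jmat_submatrix, transpose_submatrix, submatrix_mul_equiv, submatrix_mul_equiv]
    exact ⟨fun h => (reindex e.symm e.symm).injective h, fun h => by rw [h]⟩
  obtain ⟨p, hp, V, hV, hHV⟩ := exists_symplectic_congr_diagonal ((mem_iff H).2 hs)
    (hH.submatrix e)
  let V' := V.submatrix e.symm e.symm
  let d : Fin (2 * n) → ℝ := fun i => if (i : ℕ) % n < p then 1 else -1
  have hd : Hmat n p = diagonal fun i => (d i : ℂ) := by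
    simp [Hmat, d, apply_ite Complex.ofReal]
  have hde : ∀ i, d (e (.inl i)) = (if (i : ℕ) < p then 1 else -1) ∧
      d (e (.inr i)) = (if (i : ℕ) < p then 1 else -1) := fun i => by
    simp [d, e, finSumFinEquivTwoMul, Nat.mod_eq_of_lt]
  have hVe : V'.submatrix e e = V := by simp [V']
  have hV' : IsUnit V'.det := by
    rw [det_submatrix_equiv_self]
    exact SymplecticGroup.symplectic_det hV
  have hHe : H = V' * Hmat n p * V'ᴴ := by
    apply (reindex e.symm e.symm).injective
    simp only [reindex_apply, Equiv.symm_symm]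
    rw [hHV, ← submatrix_mul_equiv _ _ _ e, ← submatrix_mul_equiv _ _ _ e,
      ← conjTranspose_submatrix, hVe, hd, submatrix_diagonal_equiv]
    congr 3
    ext (i | i) <;> simp [hde]
  refine ⟨p, hp, ?_, V', (mem_iff _).1 (by rwa [hVe]), hHe⟩
  have hpos : ∀ r : Prop, [Decidable r] → ((0 : ℝ) < (if r then 1 else -1) ↔ r) := fun r _ => by
    split_ifs with h <;> simp [h]
  have hcard : Fintype.card {i : Fin n // (i : ℕ) < p} = p := by
    rw [← Fintype.card_congr (Fin.castLEquiv hp), Fintype.card_fin]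
  rw [hH.card_pos_eigenvalues_of_congr d V' hV' (hd ▸ hHe),
    ← Fintype.card_congr (e.subtypeEquiv (p := fun i => 0 < d (e i)) fun _ => Iff.rfl),
    Fintype.card_congr Equiv.subtypeSum, Fintype.card_sum]
  simp only [hde, hpos, hcard, two_mul]
end

section
/- Let n ≥ 1 and let K ∈ M_{2n,2n}(ℂ) be Hermitian (K = K̄ᵗ) and satisfy Kᵗ J_{2n} K = −J_{2n}. If v ∈ ℂ^{2n} is a nonzero vector with Kv = λv for some λ ∈ ℂ, then λ is real and nonzero, and K(J_{2n} v̄) = (−1/λ)·(J_{2n} v̄), where v̄ denotes the entrywise complex conjugate of v. In particular J_{2n}v̄ is an eigenvector of K with eigenvalue −1/λ, and λ ≠ −1/λ. -/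
open Matrix

theorem Jmat_mul_self (n : ℕ) : Jmat n * Jmat n = -1 := by
  ext i j
  rw [Matrix.mul_apply]
  by_cases hi : (i : ℕ) < n
  · rw [Finset.sum_eq_single (⟨i + n, by omega⟩ : Fin (2 * n))]
    · simp only [Jmat, Matrix.of_apply, Matrix.neg_apply, Matrix.one_apply, Fin.ext_iff]
      split_ifs <;> first | omega | simp
    · intro k _ hk
      have hk' : (k : ℕ) ≠ i + n := fun h => hk (Fin.ext h)
      simp only [Jmat, Matrix.of_apply]
      rw [if_neg (by omega), if_neg (by omega), zero_mul]
    · simp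
  · rw [Finset.sum_eq_single (⟨i - n, by omega⟩ : Fin (2 * n))]
    · simp only [Jmat, Matrix.of_apply, Matrix.neg_apply, Matrix.one_apply, Fin.ext_iff]
      split_ifs <;> first | omega | simp
    · intro k _ hk
      have hk' : (k : ℕ) ≠ i - n := fun h => hk (Fin.ext h)
      simp only [Jmat, Matrix.of_apply]
      rw [if_neg (by omega), if_neg (by omega), zero_mul]
    · simp

theorem mul_Jmat_mul_transpose {n : ℕ} {K : Matrix (Fin (2 * n)) (Fin (2 * n)) ℂ}
    (hs : Kᵀ * Jmat n * K = -(Jmat n)) : K * Jmat n * Kᵀ = -(Jmat n) := by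
  have hJ := Jmat_mul_self n
  have hright : Kᵀ * (Jmat n * K * Jmat n) = 1 := by
    rw [← Matrix.mul_assoc, ← Matrix.mul_assoc, hs, Matrix.neg_mul, hJ, neg_neg]
  have hleft : Jmat n * (K * Jmat n * Kᵀ) = 1 := by
    simpa only [Matrix.mul_assoc] using mul_eq_one_comm.mp hright
  have h := congrArg (Jmat n * ·) hleft
  simp only [← Matrix.mul_assoc, hJ, Matrix.mul_one, Matrix.neg_mul, Matrix.one_mul] at h
  exact neg_eq_iff_eq_neg.mp h

theorem Matrix.IsHermitian.transpose_mulVec_star {ι : Type*} [Fintype ι] {K : Matrix ι ι ℂ}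
    (hK : K.IsHermitian) {v : ι → ℂ} {μ : ℂ} (heig : K *ᵥ v = μ • v) :
    Kᵀ *ᵥ star v = star μ • star v := by
  rw [Matrix.mulVec_transpose, ← star_smul, ← heig, Matrix.star_mulVec, hK.eq]

theorem Matrix.IsHermitian.star_eq_of_mulVec_eq_smul {ι : Type*} [Fintype ι] {K : Matrix ι ι ℂ}
    (hK : K.IsHermitian) {v : ι → ℂ} (hv : v ≠ 0) {μ : ℂ} (heig : K *ᵥ v = μ • v) :
    star μ = μ := by
  have h : star v ⬝ᵥ K *ᵥ v = (Kᵀ *ᵥ star v) ⬝ᵥ v := by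
    rw [Matrix.dotProduct_mulVec, Matrix.mulVec_transpose]
  rw [heig, hK.transpose_mulVec_star heig, dotProduct_smul, smul_dotProduct] at h
  refine (mul_right_cancel₀ ?_ h).symm
  open ComplexOrder in exact fun h0 => hv (dotProduct_star_self_eq_zero.mp h0)

/-- If `K` is Hermitian with `Kᵗ J K = −J` and `Kv = λv` with `v ≠ 0`, then `λ` is real
and nonzero, `J v̄` is an eigenvector of `K` with eigenvalue `−1/λ`, and `λ ≠ −1/λ`. -/
theorem stmt_11 (n : ℕ) (hn : 1 ≤ n) (K : Matrix (Fin (2 * n)) (Fin (2 * n)) ℂ)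
    (hK : K.IsHermitian) (hs : Kᵀ * Jmat n * K = -(Jmat n))
    (v : Fin (2 * n) → ℂ) (hv : v ≠ 0) (lam : ℂ) (heig : K.mulVec v = lam • v) :
    lam.im = 0 ∧ lam ≠ 0 ∧
      K.mulVec ((Jmat n).mulVec (star v)) = (-1 / lam) • ((Jmat n).mulVec (star v)) ∧
      (Jmat n).mulVec (star v) ≠ 0 ∧ lam ≠ -1 / lam := by
  have hreal := hK.star_eq_of_mulVec_eq_smul hv heig
  have him : lam.im = 0 := Complex.conj_eq_iff_im.mp hreal
  have hne : Jmat n *ᵥ star v ≠ 0 := by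
    intro h
    have h' := congrArg (Jmat n *ᵥ ·) h
    simp only [Matrix.mulVec_mulVec, Jmat_mul_self, Matrix.neg_mulVec, Matrix.one_mulVec,
      Matrix.mulVec_zero, neg_eq_zero, star_eq_zero] at h'
    exact hv h'
  have key : lam • (K *ᵥ (Jmat n *ᵥ star v)) = -(Jmat n *ᵥ star v) := by
    rw [← Matrix.neg_mulVec, ← mul_Jmat_mul_transpose hs, ← Matrix.mulVec_mulVec,
      hK.transpose_mulVec_star heig, hreal, Matrix.mulVec_smul, Matrix.mulVec_mulVec]
  have hlam : lam ≠ 0 := by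
    rintro rfl
    rw [zero_smul, zero_eq_neg] at key
    exact hne key
  refine ⟨him, hlam, ?_, hne, ?_⟩
  · rw [← inv_smul_smul₀ hlam (K *ᵥ (Jmat n *ᵥ star v)), key, smul_neg, neg_div, one_div, neg_smul]
  · intro h
    rw [eq_div_iff hlam] at h
    have hre := congrArg Complex.re h
    simp only [Complex.mul_re, him, Complex.neg_re, Complex.one_re] at hre
    nlinarith [mul_self_nonneg lam.re]
end

section
/- Let n ≥ 1 and regard elements of M_{1,2n}(ℂ) as complex row vectors of length 2n. Define ψ : M_{1,2n}(ℂ) → M_{2n,1}(ℂ) by ψ(z) = J_{2n} zᵗ. Then the 3-bracket on M_{1,2n}(ℂ) defined by [a,b,c] = −a b̄ᵗ c + c b̄ᵗ a − c ψ(a) (ψ(b̄))ᵗ is ℂ-linear in the first and third arguments, conjugate-linear in the second, and satisfies anti-commutativity [a,b,c] = −[c,b,a] and the fundamental identity [a,b,[x,y,z]] = [[a,b,x],y,z] − [x,[b,a,y],z] + [x,y,[a,b,z]]; i.e., it defines a physical N=6 3-algebra (denoted C³(2n)_{ph,C₀}). -/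
open Matrix

theorem Jmat_transpose (n : ℕ) : (Jmat n)ᵀ = -Jmat n := by
  ext i j
  simp only [Jmat, transpose_apply, of_apply, Matrix.neg_apply]
  split_ifs <;> first | omega | simp

theorem Jmat_conjTranspose (n : ℕ) : (Jmat n)ᴴ = -Jmat n := by
  rw [← Jmat_transpose]
  ext i j
  simp only [Jmat, transpose_apply, conjTranspose_apply, of_apply]
  split_ifs <;> simp

/-- A `1 × 1` matrix acts on row vectors by scalar multiplication. -/
theorem mul_eq_smul_row {m : Type*} (A : Matrix (Fin 1) (Fin 1) ℂ) (c : Matrix (Fin 1) m ℂ) :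
    A * c = A 0 0 • c := by
  ext i j
  fin_cases i
  simp only [mul_apply, Fin.sum_univ_one]
  rfl

/-- The bracket `-⟨a, b⟩ c + ⟨c, b⟩ a - ω(c, a) j(b)` built from a Hermitian form `h`, a
symplectic form `w` and a compatible quaternionic structure `j` satisfies the fundamental
identity. -/
theorem fundamental_identity_of_forms {E : Type*} [AddCommGroup E] [Module ℂ E]
    (h : E →ₗ[ℂ] E →ₗ⋆[ℂ] ℂ) (w : E →ₗ[ℂ] E →ₗ[ℂ] ℂ) (j : E →ₗ⋆[ℂ] E)
    (hh : ∀ a b, starRingEnd ℂ (h a b) = h b a) (hw : ∀ a b, w a b = -w b a)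
    (hj : ∀ a, j (j a) = -a) (hhj : ∀ a b, h a (j b) = w a b)
    (hwj : ∀ a b, w a (j b) = -h a b)
    (br : E → E → E → E) (hbr : ∀ a b c, br a b c = -(h a b • c) + h c b • a - w c a • j b)
    (a b x y z : E) :
    br a b (br x y z) = br (br a b x) y z - br x (br b a y) z + br x y (br a b z) := by
  have hjh (a b : E) : h (j a) b = starRingEnd ℂ (w b a) := by rw [← hh, hhj]
  have hjw (a b : E) : w (j a) b = h b a := by rw [hw, hwj, neg_neg]
  simp only [hbr, map_add, map_sub, map_neg, map_smulₛₗ, LinearMap.add_apply,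
    LinearMap.sub_apply, LinearMap.neg_apply, LinearMap.smul_apply, hh, hj, hhj, hwj, hjh, hjw,
    RingHom.id_apply, smul_eq_mul]
  rw [hw z x, hw z a, hw x a, hw y b]
  simp only [map_neg]
  module

/-- The Hermitian form `a b̄ᵗ` on row vectors. -/
noncomputable def rowHermitianForm (m : ℕ) :
    Matrix (Fin 1) (Fin m) ℂ →ₗ[ℂ] Matrix (Fin 1) (Fin m) ℂ →ₗ⋆[ℂ] ℂ :=
  LinearMap.mk₂'ₛₗ _ _ (fun a b => (a * bᴴ) 0 0)
    (by simp [Matrix.add_mul]) (by simp) (by simp [Matrix.mul_add]) (by simp)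

/-- The symplectic form `a J bᵗ` on row vectors. -/
noncomputable def rowSymplecticForm (n : ℕ) :
    Matrix (Fin 1) (Fin (2 * n)) ℂ →ₗ[ℂ] Matrix (Fin 1) (Fin (2 * n)) ℂ →ₗ[ℂ] ℂ :=
  LinearMap.mk₂ ℂ (fun a b => (a * (Jmat n * bᵀ)) 0 0)
    (by simp [Matrix.add_mul]) (by simp) (by simp [Matrix.mul_add]) (by simp)

/-- The quaternionic structure `b ↦ (J b̄ᵗ)ᵗ` on row vectors. -/
noncomputable def rowQuaternionicStructure (n : ℕ) :
    Matrix (Fin 1) (Fin (2 * n)) ℂ →ₗ⋆[ℂ] Matrix (Fin 1) (Fin (2 * n)) ℂ where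
  toFun b := (Jmat n * bᴴ)ᵀ
  map_add' a b := by simp [Matrix.mul_add]
  map_smul' l b := by simp

theorem rowHermitianForm_conj (m : ℕ) (a b : Matrix (Fin 1) (Fin m) ℂ) :
    starRingEnd ℂ (rowHermitianForm m a b) = rowHermitianForm m b a := by
  change star ((a * bᴴ) 0 0) = (b * aᴴ) 0 0
  rw [← conjTranspose_apply, conjTranspose_mul, conjTranspose_conjTranspose]

theorem rowSymplecticForm_antisymm (n : ℕ) (a b : Matrix (Fin 1) (Fin (2 * n)) ℂ) :
    rowSymplecticForm n a b = -rowSymplecticForm n b a := by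
  change (a * (Jmat n * bᵀ)) 0 0 = -(b * (Jmat n * aᵀ)) 0 0
  rw [← transpose_apply (a * (Jmat n * bᵀ)), ← Matrix.neg_apply, transpose_mul, transpose_mul,
    transpose_transpose, Jmat_transpose, Matrix.mul_neg, Matrix.neg_mul, Matrix.mul_assoc]

theorem rowQuaternionicStructure_conjTranspose (n : ℕ) (b : Matrix (Fin 1) (Fin (2 * n)) ℂ) :
    (rowQuaternionicStructure n b)ᴴ = Jmat n * bᵀ := by
  change ((Jmat n * bᴴ)ᵀ)ᴴ = _
  have hb : bᴴᵀᴴ = bᵀ := by ext; simp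
  have hJ : (Jmat n)ᵀᴴ = Jmat n := by
    rw [Jmat_transpose, conjTranspose_neg, Jmat_conjTranspose, neg_neg]
  rw [transpose_mul, conjTranspose_mul, hb, hJ]

theorem rowQuaternionicStructure_sq (n : ℕ) (b : Matrix (Fin 1) (Fin (2 * n)) ℂ) :
    rowQuaternionicStructure n (rowQuaternionicStructure n b) = -b := by
  change (Jmat n * (rowQuaternionicStructure n b)ᴴ)ᵀ = -b
  rw [rowQuaternionicStructure_conjTranspose, ← Matrix.mul_assoc, Jmat_mul_self]
  simp

theorem rowHermitianForm_quaternionic (n : ℕ) (a b : Matrix (Fin 1) (Fin (2 * n)) ℂ) :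
    rowHermitianForm (2 * n) a (rowQuaternionicStructure n b) = rowSymplecticForm n a b := by
  change (a * (rowQuaternionicStructure n b)ᴴ) 0 0 = (a * (Jmat n * bᵀ)) 0 0
  rw [rowQuaternionicStructure_conjTranspose]

theorem rowSymplecticForm_quaternionic (n : ℕ) (a b : Matrix (Fin 1) (Fin (2 * n)) ℂ) :
    rowSymplecticForm n a (rowQuaternionicStructure n b) = -rowHermitianForm (2 * n) a b := by
  rw [← rowHermitianForm_quaternionic, rowQuaternionicStructure_sq, map_neg]

/-- With `ψ(z) = J_{2n} zᵗ`, the bracket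
`[a,b,c] = −a b̄ᵗ c + c b̄ᵗ a − c ψ(a) (ψ(b̄))ᵗ` makes the space of complex row
vectors of length `2n` a physical `N=6` 3-algebra (`C³(2n)_{ph,C₀}`). -/
theorem stmt_12 (n : ℕ) (hn : 1 ≤ n) :
    ∀ br : Matrix (Fin 1) (Fin (2 * n)) ℂ → Matrix (Fin 1) (Fin (2 * n)) ℂ →
        Matrix (Fin 1) (Fin (2 * n)) ℂ → Matrix (Fin 1) (Fin (2 * n)) ℂ,
      (∀ a b c, br a b c =
        -(a * bᴴ * c) + c * bᴴ * a - c * (Jmat n * aᵀ) * (Jmat n * bᴴ)ᵀ) →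
      ((∀ (l : ℂ) (a a' b c : Matrix (Fin 1) (Fin (2 * n)) ℂ),
          br (l • a + a') b c = l • br a b c + br a' b c) ∧
       (∀ (l : ℂ) (a b b' c : Matrix (Fin 1) (Fin (2 * n)) ℂ),
          br a (l • b + b') c = (starRingEnd ℂ) l • br a b c + br a b' c) ∧
       (∀ (l : ℂ) (a b c c' : Matrix (Fin 1) (Fin (2 * n)) ℂ),
          br a b (l • c + c') = l • br a b c + br a b c') ∧
       (∀ a b c : Matrix (Fin 1) (Fin (2 * n)) ℂ, br a b c = - br c b a) ∧
       (∀ a b x y z : Matrix (Fin 1) (Fin (2 * n)) ℂ,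
          br a b (br x y z) =
            br (br a b x) y z - br x (br b a y) z + br x y (br a b z))) := by
  intro br hbr
  have hform (a b c : Matrix (Fin 1) (Fin (2 * n)) ℂ) :
      br a b c = -(rowHermitianForm (2 * n) a b • c) + rowHermitianForm (2 * n) c b • a
        - rowSymplecticForm n c a • rowQuaternionicStructure n b := by
    rw [hbr, mul_eq_smul_row (a * bᴴ), mul_eq_smul_row (c * bᴴ),
      mul_eq_smul_row (c * (Jmat n * aᵀ))]
    rfl
  refine ⟨fun l a a' b c => ?_, fun l a b b' c => ?_, fun l a b c c' => ?_, fun a b c => ?_,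
    fundamental_identity_of_forms _ _ _ (rowHermitianForm_conj _) (rowSymplecticForm_antisymm n)
      (rowQuaternionicStructure_sq n) (rowHermitianForm_quaternionic n)
      (rowSymplecticForm_quaternionic n) br hform⟩
  iterate 3
    simp only [hform, map_add, map_smulₛₗ, LinearMap.add_apply, LinearMap.smul_apply,
      RingHom.id_apply, smul_eq_mul]
    module
  rw [hform, hform, rowSymplecticForm_antisymm n c a]
  module
end
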